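/- Let m ≥ 1 be an integer and c > 0. Then ∫_{-t}^{t} (t² − s²)^m e^{2cs} ds is asymptotically equivalent, as t → ∞, to K · e^{2ct} t^m for some constant K > 0 (specifically K = 2^m ∫_0^∞ u^m e^{-2cu} du = 2^m m!/(2c)^{m+1}). -/

import Mathlib

open Filter

open MeasureTheory Set Topology

/-- `u ^ m * exp (-(r u))` is integrable on the positive half-line. -/
theorem integrableOn_pow_mul_exp_neg_mul_Ioi (m : ℕ) {r : ℝ} (hr : 0 < r) :
    IntegrableOn (fun u : ℝ => u ^ m * Real.exp (-(r * u))) (Ioi 0) := by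
  have h := integrableOn_rpow_mul_exp_neg_mul_rpow (p := 1) (s := (m : ℝ)) (b := r)
    (by linarith [(Nat.cast_nonneg m : (0 : ℝ) ≤ m)]) one_pos hr
  simpa [Real.rpow_natCast] using h

/-- The Gamma integral at a positive integer, with a rate parameter. -/
theorem integral_pow_mul_exp_neg_mul_Ioi (m : ℕ) {r : ℝ} (hr : 0 < r) :
    ∫ u in Ioi (0 : ℝ), u ^ m * Real.exp (-(r * u)) = m.factorial / r ^ (m + 1) := by
  have h := Real.integral_rpow_mul_exp_neg_mul_Ioi (a := (m : ℝ) + 1) (r := r)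
    (by positivity) hr
  rw [Real.Gamma_nat_eq_factorial] at h
  have hpow : (1 / r) ^ ((m : ℝ) + 1) = (1 / r) ^ (m + 1) := by
    rw [← Real.rpow_natCast]; push_cast; rfl
  simp only [add_sub_cancel_right, Real.rpow_natCast, hpow] at h
  rw [h, one_div, inv_pow, div_eq_inv_mul]

/-- The substitution `s = t - u`, which moves the maximum of the exponential factor to `u = 0`. -/
theorem integral_sq_sub_sq_pow_mul_exp (m : ℕ) (r : ℝ) {t : ℝ} (ht : 0 < t) :
    ∫ s in (-t)..t, (t ^ 2 - s ^ 2) ^ m * Real.exp (r * s) =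
      Real.exp (r * t) * t ^ m *
        ∫ u in Ioi (0 : ℝ), (Ioc 0 (2 * t)).indicator
          (fun u => (2 - u / t) ^ m * (u ^ m * Real.exp (-(r * u)))) u := by
  have hsub := intervalIntegral.integral_comp_sub_left (a := 0) (b := 2 * t)
    (fun s : ℝ => (t ^ 2 - s ^ 2) ^ m * Real.exp (r * s)) t
  rw [show t - 2 * t = -t by ring, sub_zero] at hsub
  rw [← hsub, setIntegral_indicator measurableSet_Ioc,
    inter_eq_self_of_subset_right Ioc_subset_Ioi_self,
    ← intervalIntegral.integral_of_le (by positivity), ← intervalIntegral.integral_const_mul]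
  refine intervalIntegral.integral_congr fun u _ => ?_
  have hbase : t ^ 2 - (t - u) ^ 2 = t * ((2 - u / t) * u) := by field_simp; ring
  have hexp : Real.exp (r * (t - u)) = Real.exp (r * t) * Real.exp (-(r * u)) := by
    rw [← Real.exp_add]; ring_nf
  simp only [hbase, hexp, mul_pow]
  ring

/-- Dominated convergence for the rescaled Laplace integral. -/
theorem tendsto_integral_indicator_two_sub_div_pow (m : ℕ) {r : ℝ} (hr : 0 < r) :
    Tendsto (fun t : ℝ => ∫ u in Ioi (0 : ℝ), (Ioc 0 (2 * t)).indicator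
        (fun u => (2 - u / t) ^ m * (u ^ m * Real.exp (-(r * u)))) u)
      atTop (𝓝 (2 ^ m * m.factorial / r ^ (m + 1))) := by
  rw [mul_div_assoc, ← integral_pow_mul_exp_neg_mul_Ioi m hr, ← integral_const_mul]
  refine tendsto_integral_filter_of_dominated_convergence
    (fun u => 2 ^ m * (u ^ m * Real.exp (-(r * u)))) ?_ ?_
    ((integrableOn_pow_mul_exp_neg_mul_Ioi m hr).const_mul _) ?_
  · refine Eventually.of_forall fun t => ?_
    exact (Measurable.indicator (by fun_prop) measurableSet_Ioc).aestronglyMeasurable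
  · filter_upwards [eventually_gt_atTop 0] with t ht
    filter_upwards [ae_restrict_mem measurableSet_Ioi] with u hu
    have hu : 0 < u := hu
    by_cases hmem : u ∈ Ioc 0 (2 * t)
    · have hle : u / t ≤ 2 := (div_le_iff₀ ht).2 hmem.2
      have hnonneg : 0 ≤ u / t := by positivity
      have hfactor : 0 ≤ 2 - u / t := by linarith
      rw [indicator_of_mem hmem, Real.norm_of_nonneg (by positivity)]
      gcongr
      linarith
    · rw [indicator_of_notMem hmem, norm_zero]
      positivity
  · filter_upwards [ae_restrict_mem measurableSet_Ioi] with u hu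
    have hlim : Tendsto (fun t : ℝ => (2 - u / t) ^ m * (u ^ m * Real.exp (-(r * u)))) atTop
        (𝓝 (2 ^ m * (u ^ m * Real.exp (-(r * u))))) := by
      simpa using ((tendsto_const_nhds.sub
        (tendsto_const_nhds.div_atTop tendsto_id : Tendsto (fun t : ℝ => u / t) atTop (𝓝 0))).pow
          m).mul_const (u ^ m * Real.exp (-(r * u)))
    refine hlim.congr' ?_
    filter_upwards [eventually_ge_atTop (u / 2)] with t ht
    have hmem : u ∈ Ioc 0 (2 * t) := ⟨hu, by linarith⟩
    rw [indicator_of_mem hmem]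

/-- Laplace-method asymptotics: for an integer `m ≥ 1` and `c > 0`,
`∫_{-t}^{t} (t² − s²)^m e^{2cs} ds ∼ K e^{2ct} t^m` as `t → ∞`, with
`K = 2^m m! / (2c)^{m+1}`. -/
theorem laplace_integral_asymptotics (m : ℕ) (hm : 1 ≤ m) (c : ℝ) (hc : 0 < c) :
    ∃ K : ℝ, 0 < K ∧ K = 2 ^ m * (Nat.factorial m) / (2 * c) ^ (m + 1) ∧
      Tendsto (fun t : ℝ =>
          (∫ s in (-t)..t, (t ^ 2 - s ^ 2) ^ m * Real.exp (2 * c * s)) /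
            (K * Real.exp (2 * c * t) * t ^ m))
        atTop (nhds 1) := by
  have hr : 0 < 2 * c := by positivity
  have hK : (0 : ℝ) < 2 ^ m * (Nat.factorial m) / (2 * c) ^ (m + 1) := by positivity
  refine ⟨_, hK, rfl, ?_⟩
  have hlim := (tendsto_integral_indicator_two_sub_div_pow m hr).div_const
    (2 ^ m * (Nat.factorial m) / (2 * c) ^ (m + 1))
  rw [div_self hK.ne'] at hlim
  refine hlim.congr' ?_
  filter_upwards [eventually_gt_atTop 0] with t ht
  rw [integral_sq_sub_sq_pow_mul_exp m (2 * c) ht, mul_assoc (_ / _),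
    mul_comm (_ / _) (Real.exp _ * _), mul_div_mul_left _ _ (by positivity)]
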